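/- arXiv:dg-ga/9607004 — 6 statements merged into one kernel-verified Lean document; each statement's English description precedes it below -/
import Mathlib

section
/- Let 𝔤 be a finite-dimensional reductive Lie algebra over 𝔽 (𝔽 = ℝ or ℂ), and let V and W be finite-dimensional irreducible 𝔤-modules on each of which the derived algebra [𝔤,𝔤] acts nontrivially. If a linear map ρ : V → W satisfies the Schur-type condition A ρ B = B ρ A for all A, B ∈ 𝔤, then ρ = 0. -/
open LieModule LieAlgebra Polynomial in
theorem schurAux_nilp {k W : Type*} [Field k] [CharZero k] [AddCommGroup W] [Module k W]
    [FiniteDimensional k W] (y : Module.End k W)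
    (h : ∀ n : ℕ, LinearMap.trace k W (y * y ^ n) = 0) : IsNilpotent y := by
  have hpoly : ∀ p : k[X], LinearMap.trace k W (y * aeval y p) = 0 := by
    intro p
    induction p using Polynomial.induction_on' with
    | add p q hp hq => simp [mul_add, hp, hq]
    | monomial n a => simp [aeval_monomial, ← Algebra.smul_def, h]
  have hm : minpoly k y ≠ 0 := minpoly.ne_zero (Algebra.IsIntegral.isIntegral y)
  obtain ⟨q, hq, hq0⟩ := Polynomial.exists_eq_pow_rootMultiplicity_mul_and_not_dvd _ hm 0
  set r := (minpoly k y).rootMultiplicity 0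
  simp only [map_zero, sub_zero] at hq hq0
  have hcop : IsCoprime (X ^ (r + 1)) q :=
    IsCoprime.pow_left ((Polynomial.irreducible_X.coprime_iff_not_dvd).2 hq0)
  obtain ⟨u, v, huv⟩ := hcop
  have hz : aeval y (X ^ r * q) = 0 := by rw [← hq]; exact minpoly.aeval k y
  have he : IsIdempotentElem (aeval y (u * X ^ (r + 1))) := by
    have h1 : u * X ^ (r + 1) * (u * X ^ (r + 1)) =
        u * X ^ (r + 1) - u * X * v * (X ^ r * q) := by
      linear_combination (u * X ^ (r + 1)) * huv
    unfold IsIdempotentElem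
    rw [← map_mul, h1, map_sub, map_mul _ _ (X ^ r * q), hz, mul_zero, sub_zero]
  have htr : LinearMap.trace k W (aeval y (u * X ^ (r + 1))) = 0 := by
    have h1 : u * X ^ (r + 1) = X * (u * X ^ r) := by ring
    rw [h1, map_mul, aeval_X]; exact hpoly _
  have he0 := (LinearMap.IsIdempotentElem.trace_eq_zero_iff he).1 htr
  refine ⟨r, ?_⟩
  have h2 : (X ^ r : k[X]) = X ^ r * (u * X ^ (r + 1)) + v * (X ^ r * q) := by
    linear_combination (- X ^ r) * huv
  have h3 := congrArg (aeval y) h2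
  rw [map_add, map_mul _ (X ^ r), map_mul _ v, he0, hz] at h3
  simpa using h3

section
set_option linter.unusedSectionVars false
variable {k g W : Type*} [Field k] [CharZero k] [LieRing g] [LieAlgebra k g]
    [AddCommGroup W] [Module k W] [LieRingModule g W] [LieModule k g W]
    [FiniteDimensional k W] [LieModule.IsIrreducible k g W]

/-- vectors killed by an ideal acting nontrivially are zero -/
theorem schurAux_inv (J : LieIdeal k g) (w : W) (hw0 : w ≠ 0) (hw : ∀ x ∈ J, ⁅x, w⁆ = 0) :
    ∀ x ∈ J, ∀ w : W, ⁅x, w⁆ = 0 := by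
  let N : LieSubmodule k g W :=
    { carrier := {w | ∀ x ∈ J, ⁅x, w⁆ = 0}
      add_mem' := by
        intro a b ha hb x hx
        rw [lie_add, ha x hx, hb x hx, add_zero]
      zero_mem' := by intro x _; simp
      smul_mem' := by
        intro c a ha x hx
        rw [lie_smul, ha x hx, smul_zero]
      lie_mem := by
        intro y a ha x hx
        have h1 : ⁅x, y⁆ ∈ J := lie_mem_left k g J x y hx
        rw [leibniz_lie, ha _ h1, ha x hx, lie_zero, add_zero] }
  have hN : N ≠ ⊥ := by
    intro h
    have : w ∈ N := hw
    rw [h] at this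
    exact hw0 (by simpa using this)
  have hT : N = ⊤ := (eq_bot_or_eq_top N).resolve_left hN
  intro x hx w
  have : w ∈ N := by rw [hT]; trivial
  exact this x hx

theorem schurAux_engel (J : LieIdeal k g)
    (h : ∀ x ∈ J, IsNilpotent (LieModule.toEnd k g W x)) :
    ∀ x ∈ J, ∀ w : W, ⁅x, w⁆ = 0 := by
  have _ := LieModule.nontrivial_of_isIrreducible k g W
  have hn : LieModule.IsNilpotent J W := by
    rw [LieModule.isNilpotent_iff_forall' (R := k)]
    rintro ⟨x, hx⟩
    exact h x hx
  have := LieModule.nontrivial_max_triv_of_isNilpotent k J W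
  obtain ⟨⟨w, hw⟩, hne⟩ := exists_ne (0 : LieModule.maxTrivSubmodule k J W)
  refine schurAux_inv J w (fun h => hne (by ext; simpa using h)) ?_
  intro x hx
  exact (LieModule.mem_maxTrivSubmodule k J W w).1 hw ⟨x, hx⟩

theorem schurAux_trace (J₁ J₂ : LieIdeal k g) (p : Module.End k W)
    (hp : ∀ b ∈ J₂, Commute (LieModule.toEnd k g W b) p) (y : g) (hy : y ∈ ⁅J₁, J₂⁆) :
    LinearMap.trace k W (LieModule.toEnd k g W y * p) = 0 := by
  rw [← LieSubmodule.mem_toSubmodule, LieSubmodule.lieIdeal_oper_eq_linear_span'] at hy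
  induction hy using Submodule.span_induction with
  | mem z hz =>
    obtain ⟨a, -, b, hb, rfl⟩ := hz
    have h1 := (hp b hb).eq
    have h2 : LieModule.toEnd k g W ⁅a, b⁆ = LieModule.toEnd k g W a * LieModule.toEnd k g W b -
        LieModule.toEnd k g W b * LieModule.toEnd k g W a := by
      ext w; simp
    rw [h2, sub_mul, map_sub, mul_assoc, h1, ← mul_assoc,
      mul_assoc (LieModule.toEnd k g W b), LinearMap.trace_mul_comm k (LieModule.toEnd k g W b),
      sub_self]
  | zero => simp
  | add a b _ _ ha hb => simp [add_mul, ha, hb]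
  | smul c a _ ha => simp [ha]

theorem schurAux_zero (J J₁ J₂ : LieIdeal k g) (hJ : J ≤ ⁅J₁, J₂⁆)
    (hc : ∀ x ∈ J, ∀ b ∈ J₂,
      Commute (LieModule.toEnd k g W b) (LieModule.toEnd k g W x)) :
    ∀ x ∈ J, ∀ w : W, ⁅x, w⁆ = 0 := by
  refine schurAux_engel J fun x hx => schurAux_nilp _ fun n => ?_
  exact schurAux_trace J₁ J₂ _ (fun b hb => (hc x hx b hb).pow_right n) x (hJ hx)

theorem schurAux_rad (x : g) (hx : x ∈ (⁅(⊤ : LieIdeal k g), (⊤ : LieIdeal k g)⁆ : LieIdeal k g))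
    (h : ∀ y ∈ (⁅(⊤ : LieIdeal k g), (⊤ : LieIdeal k g)⁆ : LieIdeal k g),
      LieModule.traceForm k g W x y = 0) : ∀ w : W, ⁅x, w⁆ = 0 := by
  set I : LieIdeal k g := ⁅(⊤ : LieIdeal k g), (⊤ : LieIdeal k g)⁆
  let K : LieIdeal k g :=
    { carrier := {x | x ∈ I ∧ ∀ y ∈ I, LieModule.traceForm k g W x y = 0}
      add_mem' := by
        rintro a b ⟨ha, ha'⟩ ⟨hb, hb'⟩
        refine ⟨add_mem ha hb, fun y hy => ?_⟩
        rw [map_add, LinearMap.add_apply, ha' y hy, hb' y hy, add_zero]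
      zero_mem' := ⟨zero_mem _, by intro y _; simp⟩
      smul_mem' := by
        rintro c a ⟨ha, ha'⟩
        refine ⟨I.smul_mem c ha, fun y hy => ?_⟩
        rw [map_smul, LinearMap.smul_apply, ha' y hy, smul_zero]
      lie_mem := by
        rintro z a ⟨ha, ha'⟩
        refine ⟨I.lie_mem ha, fun y hy => ?_⟩
        rw [← lie_skew, map_neg, LinearMap.neg_apply, LieModule.traceForm_apply_lie_apply,
          ha' _ (I.lie_mem hy), neg_zero] }
  have hxK : x ∈ K := ⟨hx, h⟩
  -- step 1
  have htf : LieModule.traceForm k K W = 0 := by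
    ext ⟨a, ha⟩ ⟨b, hb⟩
    exact ha.2 b hb.1
  have hnil := LieModule.isNilpotent_derivedSeries_of_traceForm_eq_zero htf
  have h1 : ∀ z ∈ ⁅K, K⁆, ∀ w : W, ⁅z, w⁆ = 0 := by
    refine schurAux_engel _ fun z hz => ?_
    refine (LieModule.isNilpotent_iff_forall' (R := k)).mp hnil
      ⟨⟨z, LieSubmodule.lie_le_left K K hz⟩, ?_⟩
    rwa [LieIdeal.derivedSeries_eq_derivedSeriesOfIdeal_comap, LieIdeal.mem_comap]
  have comm_of : ∀ a b : g, (∀ w : W, ⁅⁅a, b⁆, w⁆ = 0) →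
      Commute (LieModule.toEnd k g W a) (LieModule.toEnd k g W b) := by
    intro a b hab
    ext w
    have := hab w
    rw [lie_lie, sub_eq_zero] at this
    exact this
  have hle : ⁅(⊤ : LieIdeal k g), K⁆ ≤ K := LieSubmodule.lie_le_right _ _
  have h2 : ∀ z ∈ ⁅(⊤ : LieIdeal k g), K⁆, ∀ w : W, ⁅z, w⁆ = 0 := by
    refine schurAux_zero _ ⊤ K le_rfl fun a ha b hb => comm_of _ _ (h1 _ ?_)
    exact LieSubmodule.lie_mem_lie hb (hle ha)
  exact schurAux_zero K ⊤ ⊤ (fun z hz => hz.1)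
    (fun a ha b _ => comm_of _ _ (h2 _ (LieSubmodule.lie_mem_lie (LieSubmodule.mem_top _) ha))) x hxK

/-- dual families for the trace form on the derived algebra -/
theorem schurAux_dual (hW : ∃ (x : g) (w : W),
      x ∈ (⁅(⊤ : LieIdeal k g), (⊤ : LieIdeal k g)⁆ : LieIdeal k g) ∧ ⁅x, w⁆ ≠ 0) :
    ∃ (n : ℕ) (x y : Fin n → g), n ≠ 0 ∧
      (∀ i, x i ∈ (⁅(⊤ : LieIdeal k g), (⊤ : LieIdeal k g)⁆ : LieIdeal k g)) ∧
      (∀ i, y i ∈ (⁅(⊤ : LieIdeal k g), (⊤ : LieIdeal k g)⁆ : LieIdeal k g)) ∧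
      (∀ i, LieModule.traceForm k g W (x i) (y i) = 1) ∧
      (∀ z ∈ (⁅(⊤ : LieIdeal k g), (⊤ : LieIdeal k g)⁆ : LieIdeal k g),
        LieModule.toEnd k g W z =
          ∑ j, LieModule.traceForm k g W z (y j) • LieModule.toEnd k g W (x j)) ∧
      (∀ z ∈ (⁅(⊤ : LieIdeal k g), (⊤ : LieIdeal k g)⁆ : LieIdeal k g),
        LieModule.toEnd k g W z =
          ∑ j, LieModule.traceForm k g W z (x j) • LieModule.toEnd k g W (y j)) := by
  have hrad := schurAux_rad (k := k) (g := g) (W := W)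
  set I : LieIdeal k g := ⁅(⊤ : LieIdeal k g), (⊤ : LieIdeal k g)⁆
  let E : Submodule k (Module.End k W) :=
    I.toSubmodule.map (LieModule.toEnd k g W : g →ₗ[k] Module.End k W)
  let T : LinearMap.BilinForm k (Module.End k W) :=
    (LinearMap.mul k (Module.End k W)).compr₂ (LinearMap.trace k W)
  have hT : ∀ a b, T a b = LinearMap.trace k W (a * b) := fun _ _ => rfl
  have hTf : ∀ a b : g, T (LieModule.toEnd k g W a) (LieModule.toEnd k g W b) =
    LieModule.traceForm k g W a b := fun _ _ => rfl
  let B : LinearMap.BilinForm k E := T.restrict E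
  have hBdef : ∀ a b : E, B a b = T a b := fun _ _ => rfl
  have hsymm : B.IsSymm := ⟨fun a b => by
    simp only [hBdef, hT, RingHom.id_apply]; exact LinearMap.trace_mul_comm k _ _⟩
  have hmem : ∀ z ∈ I, LieModule.toEnd k g W z ∈ E := fun z hz => ⟨z, hz, rfl⟩
  have hnd : B.Nondegenerate := by
    refine (LinearMap.IsRefl.nondegenerate_iff_separatingLeft (B := B) hsymm.isRefl).2 ?_
    rintro ⟨_, z, hz, rfl⟩ hzz
    ext w
    exact hrad z hz (fun y hy => hzz ⟨_, hmem y hy⟩) w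
  let b := Module.finBasis k E
  let b' := B.dualBasis hnd b
  have hx : ∀ i, ∃ z ∈ I, LieModule.toEnd k g W z = b i := fun i => (b i).2
  have hy : ∀ i, ∃ z ∈ I, LieModule.toEnd k g W z = b' i := fun i => (b' i).2
  choose x hxI hx using hx
  choose y hyI hy using hy
  refine ⟨_, x, y, ?_, hxI, hyI, ?_, ?_, ?_⟩
  · intro h0
    rw [Module.finrank_zero_iff] at h0
    obtain ⟨z, w, hz, hzw⟩ := hW
    have h3 := Subsingleton.elim (⟨_, hmem z hz⟩ : E) 0
    have h4 : LieModule.toEnd k g W z = 0 := congrArg Subtype.val h3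
    exact hzw (by rw [← LieModule.toEnd_apply_apply k, h4]; rfl)
  · intro i
    rw [← hTf, hx, hy, ← hBdef, LinearMap.BilinForm.apply_dualBasis_right hnd hsymm, if_pos rfl]
  · intro z hz
    have h3 := (B.dualBasis hnd b').sum_repr ⟨_, hmem z hz⟩
    simp only [LinearMap.BilinForm.dualBasis_repr_apply] at h3
    rw [show B.dualBasis hnd b' = b from LinearMap.BilinForm.dualBasis_dualBasis hnd hsymm b] at h3
    have h4 := congrArg Subtype.val h3
    refine h4.symm.trans ?_
    simp [hBdef, ← hx, ← hy, hTf]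
  · intro z hz
    have h3 := b'.sum_repr ⟨_, hmem z hz⟩
    simp only [b', LinearMap.BilinForm.dualBasis_repr_apply] at h3
    have h4 := congrArg Subtype.val h3
    refine h4.symm.trans ?_
    simp [hBdef, ← hx, hTf, hy, b']

theorem schurAux_main (hW : ∃ (x : g) (w : W),
      x ∈ (⁅(⊤ : LieIdeal k g), (⊤ : LieIdeal k g)⁆ : LieIdeal k g) ∧ ⁅x, w⁆ ≠ 0)
    (c : g →ₗ[k] W) (hc : ∀ A B, ⁅A, c B⁆ = ⁅B, c A⁆) : c = 0 := by
  obtain ⟨n, x, y, hn, hxI, hyI, hxy, hX, hY⟩ := schurAux_dual (k := k) hW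
  have hinv := schurAux_inv (k := k) (W := W) (⁅(⊤ : LieIdeal k g), (⊤ : LieIdeal k g)⁆ : LieIdeal k g)
  set I : LieIdeal k g := ⁅(⊤ : LieIdeal k g), (⊤ : LieIdeal k g)⁆ with hI
  have hinv0 : ∀ u : W, (∀ z ∈ I, ⁅z, u⁆ = 0) → u = 0 := by
    intro u hu
    by_contra hne
    obtain ⟨z, w, hz, hzw⟩ := hW
    exact hzw (hinv u hne hu z hz w)
  let t := LieModule.traceForm k g W
  have hXw : ∀ z ∈ I, ∀ w : W, ⁅z, w⁆ = ∑ j, t z (y j) • ⁅x j, w⁆ := by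
    intro z hz w
    have := congrArg (fun f => f w) (hX z hz)
    simpa using this
  have hYw : ∀ z ∈ I, ∀ w : W, ⁅z, w⁆ = ∑ j, t z (x j) • ⁅y j, w⁆ := by
    intro z hz w
    have := congrArg (fun f => f w) (hY z hz)
    simpa using this
  have hker : ∀ z, (∀ w : W, ⁅z, w⁆ = 0) → c z = 0 := by
    intro z hz
    refine hinv0 _ fun a _ => ?_
    rw [hc, hz]
  have hXc : ∀ z ∈ I, c z = ∑ j, t z (y j) • c (x j) := by
    intro z hz
    have := hker (z - ∑ j, t z (y j) • x j) (fun w => by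
      rw [sub_lie, sum_lie, hXw z hz]; simp)
    simpa [sub_eq_zero] using this
  have hYc : ∀ z ∈ I, c z = ∑ j, t z (x j) • c (y j) := by
    intro z hz
    have := hker (z - ∑ j, t z (x j) • y j) (fun w => by
      rw [sub_lie, sum_lie, hYw z hz]; simp)
    simpa [sub_eq_zero] using this
  have hCI : ∀ C : g, ∀ z ∈ I, ⁅C, z⁆ ∈ I := fun C z hz => I.lie_mem hz
  have hskew : ∀ (C a b : g), t ⁅C, a⁆ b = - t ⁅C, b⁆ a := by
    intro C a b
    have := LieModule.traceForm_apply_lie_apply' k g W C a b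
    rw [LieModule.traceForm_comm k g W a] at this
    exact this
  -- invariance
  have inv1 : ∀ (C : g) (f : g → W) (hf : ∀ z ∈ I, f z = ∑ j, t z (x j) • f (y j)),
      ∑ i, ⁅⁅C, x i⁆, f (y i)⁆ = - ∑ i, ⁅x i, f ⁅C, y i⁆⁆ := by
    intro C f hf
    have e1 : ∀ i, ⁅⁅C, x i⁆, f (y i)⁆ = ∑ j, t ⁅C, x i⁆ (y j) • ⁅x j, f (y i)⁆ :=
      fun i => hXw _ (hCI C _ (hxI i)) _
    have e2 : ∀ i, ⁅x i, f ⁅C, y i⁆⁆ = ∑ j, t ⁅C, y i⁆ (x j) • ⁅x i, f (y j)⁆ := by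
      intro i
      rw [hf _ (hCI C _ (hyI i)), lie_sum]
      simp
    simp only [e1, e2]
    rw [Finset.sum_comm, ← Finset.sum_neg_distrib]
    refine Finset.sum_congr rfl fun j _ => ?_
    rw [← Finset.sum_neg_distrib]
    refine Finset.sum_congr rfl fun i _ => ?_
    rw [hskew, neg_smul]
  -- symmetry
  have symm1 : ∀ C : g, ∑ i, ⁅⁅C, y i⁆, c (x i)⁆ = ∑ i, ⁅⁅C, x i⁆, c (y i)⁆ := by
    intro C
    have e1 : ∀ i, ⁅⁅C, y i⁆, c (x i)⁆ = ∑ j, t (x i) (x j) • ⁅⁅C, y i⁆, c (y j)⁆ := by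
      intro i
      rw [hYc _ (hxI i), lie_sum]
      simp
    have e2 : ∀ i, ⁅⁅C, x i⁆, c (y i)⁆ = ∑ j, t (x i) (x j) • ⁅⁅C, y j⁆, c (y i)⁆ := by
      intro i
      rw [lie_lie, hYw _ (hxI i), hYw _ (hxI i), lie_sum, ← Finset.sum_sub_distrib]
      refine Finset.sum_congr rfl fun j _ => ?_
      rw [lie_smul, ← smul_sub, ← lie_lie]
    simp only [e1, e2]
    rw [Finset.sum_comm]
    refine Finset.sum_congr rfl fun j _ => Finset.sum_congr rfl fun i _ => ?_
    rw [show t (x i) (x j) = t (x j) (x i) from LieModule.traceForm_comm k g W _ _]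
  have vanish : ∀ C : g, ∑ i, ⁅⁅C, x i⁆, c (y i)⁆ = 0 := by
    intro C
    have h1 := inv1 C c hYc
    have h2 : ∑ i, ⁅x i, c ⁅C, y i⁆⁆ = ∑ i, ⁅⁅C, x i⁆, c (y i)⁆ := by
      rw [← symm1]
      exact Finset.sum_congr rfl fun i _ => hc _ _
    rw [h2, eq_neg_iff_add_eq_zero, ← two_smul k] at h1
    exact (smul_eq_zero.1 h1).resolve_left two_ne_zero
  let Ω : Module.End k W := ∑ i, LieModule.toEnd k g W (x i) * LieModule.toEnd k g W (y i)
  have hΩ : ∀ w, Ω w = ∑ i, ⁅x i, ⁅y i, w⁆⁆ := by intro w; simp [Ω]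
  have hΩcomm : ∀ (C : g) (w : W), Ω ⁅C, w⁆ = ⁅C, Ω w⁆ := by
    intro C w
    have h1 := inv1 C (fun z => ⁅z, w⁆) (fun z hz => hYw z hz w)
    rw [hΩ, hΩ, lie_sum, eq_comm, ← sub_eq_zero, ← Finset.sum_sub_distrib]
    rw [← add_eq_zero_iff_eq_neg, ← Finset.sum_add_distrib] at h1
    rw [← h1]
    refine Finset.sum_congr rfl fun i _ => ?_
    simp only [lie_lie, lie_sub]
    abel
  have hΩtr : LinearMap.trace k W Ω = n := by
    have : ∀ i, LinearMap.trace k W (LieModule.toEnd k g W (x i) * LieModule.toEnd k g W (y i)) = 1 :=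
      fun i => hxy i
    simp [Ω, this]
  have hΩ0 : Ω ≠ 0 := by
    intro h
    rw [h, map_zero] at hΩtr
    exact hn (by exact_mod_cast hΩtr.symm)
  let ΩL : W →ₗ⁅k, g⁆ W := { Ω with map_lie' := fun {C w} => hΩcomm C w }
  have hinj : Function.Injective Ω := by
    have : ΩL.ker = ⊥ := by
      refine (eq_bot_or_eq_top ΩL.ker).resolve_right fun h => hΩ0 ?_
      ext w
      have : w ∈ ΩL.ker := by rw [h]; trivial
      exact this
    exact (LieModuleHom.ker_eq_bot ΩL).1 this
  have hsurj : Function.Surjective Ω := LinearMap.injective_iff_surjective.1 hinj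
  obtain ⟨u, hu⟩ := hsurj (∑ i, ⁅x i, c (y i)⁆)
  have hcu : ∀ C, c C = ⁅C, u⁆ := by
    intro C
    apply hinj
    rw [hΩcomm, hu, hΩ, lie_sum, ← sub_eq_zero, ← neg_eq_zero, neg_sub,
      ← Finset.sum_sub_distrib, ← vanish C]
    refine Finset.sum_congr rfl fun i _ => ?_
    rw [lie_lie, hc (y i) C]
  have hu0 : u = 0 := by
    refine hinv0 u fun z hz => ?_
    have hz' : z ∈ I.toSubmodule := hz
    rw [hI, LieSubmodule.lieIdeal_oper_eq_linear_span'] at hz'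
    clear hz
    induction hz' using Submodule.span_induction with
    | mem z hz =>
      obtain ⟨a, -, b, -, rfl⟩ := hz
      rw [lie_lie, ← hcu, ← hcu, hc, sub_self]
    | zero => simp
    | add a b _ _ ha hb => rw [add_lie, ha, hb, add_zero]
    | smul r a _ ha => rw [smul_lie, ha, smul_zero]
  ext C
  rw [hcu, hu0]; simp
end


/-- A Lie algebra is *reductive* if its (solvable) radical coincides with its centre. -/
def LieAlgebra.IsReductive (𝔽 𝔤 : Type*) [CommRing 𝔽] [LieRing 𝔤] [LieAlgebra 𝔽 𝔤] : Prop :=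
  LieAlgebra.radical 𝔽 𝔤 = LieAlgebra.center 𝔽 𝔤

/-- **Schur-type lemma** (Lemma 4 of Chi–Merkulov–Schwachhöfer): if `𝔤` is a
finite-dimensional reductive Lie algebra over `𝔽 = ℝ` or `ℂ`, `V` and `W` are
finite-dimensional irreducible `𝔤`-modules on which the derived algebra `[𝔤,𝔤]`
acts nontrivially, and `ρ : V → W` is linear with `A ρ B = B ρ A` for all
`A, B ∈ 𝔤`, then `ρ = 0`. -/
theorem schur_type_lemma {𝔽 : Type*} [RCLike 𝔽]
    {𝔤 : Type*} [LieRing 𝔤] [LieAlgebra 𝔽 𝔤] [FiniteDimensional 𝔽 𝔤]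
    (hred : LieAlgebra.IsReductive 𝔽 𝔤)
    {V : Type*} [AddCommGroup V] [Module 𝔽 V] [LieRingModule 𝔤 V] [LieModule 𝔽 𝔤 V]
    [FiniteDimensional 𝔽 V] [LieModule.IsIrreducible 𝔽 𝔤 V]
    {W : Type*} [AddCommGroup W] [Module 𝔽 W] [LieRingModule 𝔤 W] [LieModule 𝔽 𝔤 W]
    [FiniteDimensional 𝔽 W] [LieModule.IsIrreducible 𝔽 𝔤 W]
    (hV : ∃ (x : 𝔤) (v : V), x ∈ LieAlgebra.derivedSeries 𝔽 𝔤 1 ∧ ⁅x, v⁆ ≠ 0)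
    (hW : ∃ (x : 𝔤) (w : W), x ∈ LieAlgebra.derivedSeries 𝔽 𝔤 1 ∧ ⁅x, w⁆ ≠ 0)
    (ρ : V →ₗ[𝔽] W)
    (hSchur : ∀ (A B : 𝔤) (v : V), ⁅A, ρ ⁅B, v⁆⁆ = ⁅B, ρ ⁅A, v⁆⁆) :
    ρ = 0 := by
  have h0 : ∀ (A : 𝔤) (v : V), ρ ⁅A, v⁆ = 0 := by
    intro A v
    let c : 𝔤 →ₗ[𝔽] W := ρ ∘ₗ ((LieModule.toEnd 𝔽 𝔤 V : 𝔤 →ₗ[𝔽] Module.End 𝔽 V).flip v)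
    have hc : c = 0 := schurAux_main hW c fun A B => hSchur A B v
    exact congrArg (fun f => f A) hc
  have htop : (⁅(⊤ : LieIdeal 𝔽 𝔤), (⊤ : LieSubmodule 𝔽 𝔤 V)⁆ : LieSubmodule 𝔽 𝔤 V) = ⊤ := by
    refine (eq_bot_or_eq_top _).resolve_left fun h => ?_
    obtain ⟨x, v, -, hxv⟩ := hV
    have h1 : ⁅x, v⁆ ∈ (⁅(⊤ : LieIdeal 𝔽 𝔤), (⊤ : LieSubmodule 𝔽 𝔤 V)⁆ : LieSubmodule 𝔽 𝔤 V) :=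
      LieSubmodule.lie_mem_lie (LieSubmodule.mem_top _) (LieSubmodule.mem_top _)
    rw [h] at h1
    exact hxv (by simpa using h1)
  ext v
  have hv : v ∈ (⁅(⊤ : LieIdeal 𝔽 𝔤), (⊤ : LieSubmodule 𝔽 𝔤 V)⁆ : LieSubmodule 𝔽 𝔤 V) := by
    rw [htop]; trivial
  rw [← LieSubmodule.mem_toSubmodule, LieSubmodule.lieIdeal_oper_eq_linear_span'] at hv
  have hle : Submodule.span 𝔽 {x : V | ∃ a ∈ (⊤ : LieIdeal 𝔽 𝔤), ∃ n ∈ (⊤ : LieSubmodule 𝔽 𝔤 V),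
      ⁅a, n⁆ = x} ≤ LinearMap.ker ρ := by
    rw [Submodule.span_le]
    rintro _ ⟨a, -, n, -, rfl⟩
    exact h0 a n
  exact hle hv
end

section
/- Let 𝔤 be a finite-dimensional reductive Lie algebra over 𝔽 (𝔽 = ℝ or ℂ) and V a finite-dimensional irreducible 𝔤-module on which the derived algebra [𝔤,𝔤] acts nontrivially. If a bilinear form c : V × V → 𝔽 satisfies c(x, A·y) = c(y, A·x) for all A ∈ 𝔤 and all x, y ∈ V, then c is skew-symmetric and 𝔤-invariant: c(x,y) = −c(y,x) and c(A·x, y) + c(x, A·y) = 0 for all A ∈ 𝔤, x, y ∈ V. -/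
open Module in
theorem exists_casimir {F V : Type*} [Field F] [CharZero F] [AddCommGroup V] [Module F V]
    [FiniteDimensional F V] (W : Submodule F (End F V))
    (hnd : ∀ f ∈ W, (∀ g ∈ W, LinearMap.trace F V (f * g) = 0) → f = 0) :
    ∃ (w : Fin (finrank F W) → F) (b : Fin (finrank F W) → End F V),
      (∀ i, b i ∈ W) ∧ (∀ i, w i * LinearMap.trace F V (b i * b i) = 1) ∧
      (∀ f ∈ W, f = ∑ j, (w j * LinearMap.trace F V (f * b j)) • b j) := by
  let β : LinearMap.BilinForm F W :=
    (((LinearMap.mul F (End F V)).compr₂ (LinearMap.trace F V)).domRestrict₁₂ W W)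
  have hβ : ∀ f g : W, β f g = LinearMap.trace F V (f.1 * g.1) := fun f g => rfl
  have hsymm : LinearMap.IsSymm β := ⟨fun f g => by
    simp only [hβ, RingHom.id_apply]; exact LinearMap.trace_mul_comm F _ _⟩
  have : Invertible (2 : F) := invertibleOfNonzero two_ne_zero
  obtain ⟨v, hv⟩ := LinearMap.BilinForm.exists_orthogonal_basis hsymm
  have hsep : β.SeparatingLeft := by
    intro f hf
    apply Subtype.ext
    exact hnd f.1 f.2 (fun g hg => hf ⟨g, hg⟩)
  have hne := fun i => LinearMap.IsOrthoᵢ.not_isOrtho_basis_self_of_separatingLeft hv hsep i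
  refine ⟨fun i => (β (v i) (v i))⁻¹, fun i => (v i).1, fun i => (v i).2, ?_, ?_⟩
  · intro i
    exact inv_mul_cancel₀ (hne i)
  · intro f hf
    have h1 := v.sum_repr ⟨f, hf⟩
    have h2 : ∀ j, (β (v j) (v j))⁻¹ * β ⟨f, hf⟩ (v j) = v.repr ⟨f, hf⟩ j := by
      intro j
      conv_lhs => rw [← h1]
      rw [map_sum, LinearMap.sum_apply, Finset.sum_eq_single j]
      · rw [map_smul, LinearMap.smul_apply, smul_eq_mul, mul_comm, mul_assoc,
          mul_inv_cancel₀ (hne j), mul_one]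
      · intro i _ hij
        rw [map_smul, LinearMap.smul_apply]
        have := hv hij
        simp only [Function.onFun] at this
        rw [this, smul_zero]
      · simp
    have h3 := congrArg Subtype.val h1
    rw [← Submodule.subtype_apply, map_sum] at h3
    simp only [map_smul, Submodule.subtype_apply] at h3
    conv_lhs => rw [← h3]
    refine Finset.sum_congr rfl fun j _ => ?_
    rw [← h2 j]
    rfl

open Module in
/-- Invariance of the Casimir tensor. -/
theorem casimir_inv {F V M : Type*} [Field F] [CharZero F] [AddCommGroup V] [Module F V]
    [AddCommGroup M] [Module F M] (G W : Submodule F (End F V)) (hWG : W ≤ G)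
    (hGG : ∀ f ∈ G, ∀ g ∈ G, f * g - g * f ∈ W) {n : ℕ}
    (w : Fin n → F) (b : Fin n → End F V) (hb : ∀ i, b i ∈ W)
    (hexp : ∀ f ∈ W, f = ∑ j, (w j * LinearMap.trace F V (f * b j)) • b j)
    (T : End F V →ₗ[F] End F V →ₗ[F] M)
    (hT : ∀ f ∈ W, ∀ g ∈ W, T f g = T g f) (A : End F V) (hA : A ∈ G) :
    ∑ i, w i • T (b i) (A * b i - b i * A) = 0 := by
  have e1 : ∀ i, w i • T (b i) (A * b i - b i * A) =
      ∑ j, (w i * (w j * LinearMap.trace F V ((A * b i - b i * A) * b j))) • T (b i) (b j) := by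
    intro i
    conv_lhs => rw [hexp _ (hGG A hA (b i) (hWG (hb i)))]
    rw [map_sum, Finset.smul_sum]
    refine Finset.sum_congr rfl fun j _ => ?_
    rw [map_smul, smul_smul]
  have anti : ∀ i j, LinearMap.trace F V ((A * b i - b i * A) * b j) =
      - LinearMap.trace F V ((A * b j - b j * A) * b i) := by
    intro i j
    rw [sub_mul, sub_mul, map_sub, map_sub, mul_assoc (b i) A (b j),
      LinearMap.trace_mul_comm F (b i) (A * b j), mul_assoc (b j) A (b i),
      LinearMap.trace_mul_comm F (b j) (A * b i)]
    ring
  have e2 : ∑ i, w i • T (b i) (A * b i - b i * A) =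
      - ∑ i, w i • T (b i) (A * b i - b i * A) := by
    conv_lhs => rw [Finset.sum_congr rfl fun i _ => e1 i, Finset.sum_comm]
    rw [Finset.sum_congr rfl fun i _ => e1 i, ← Finset.sum_neg_distrib]
    refine Finset.sum_congr rfl fun j _ => ?_
    rw [← Finset.sum_neg_distrib]
    refine Finset.sum_congr rfl fun i _ => ?_
    rw [hT _ (hb i) _ (hb j), anti i j, ← neg_smul]
    congr 1
    ring
  have e3 : (2 : F) • ∑ i, w i • T (b i) (A * b i - b i * A) = 0 := by
    rw [two_smul]
    nth_rewrite 1 [e2]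
    simp
  exact (smul_eq_zero.mp e3).resolve_left two_ne_zero

open Module in
theorem core_lemma {F V : Type*} [Field F] [CharZero F] [AddCommGroup V] [Module F V]
    [FiniteDimensional F V] (G W : Submodule F (End F V)) (hWG : W ≤ G)
    (hGG : ∀ f ∈ G, ∀ g ∈ G, f * g - g * f ∈ W)
    (hnd : ∀ f ∈ W, (∀ g ∈ W, LinearMap.trace F V (f * g) = 0) → f = 0)
    (hW : W ≠ ⊥)
    (hirr : ∀ U : Submodule F V, (∀ f ∈ G, ∀ u ∈ U, f u ∈ U) → U = ⊥ ∨ U = ⊤)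
    (hD : ∀ l : V →ₗ[F] F, (∀ f ∈ G, ∀ g ∈ G, ∀ v, l ((f * g - g * f) v) = 0) → l = 0)
    (s : V →ₗ[F] V →ₗ[F] F)
    (hs : ∀ f ∈ G, ∀ g ∈ G, ∀ x y, s (f x) (g y) = s (g x) (f y)) : s = 0 := by
  obtain ⟨w, b, hb, hw, hexp⟩ := exists_casimir W hnd
  let Ω : End F V := ∑ i, w i • (b i * b i)
  have hcomm : ∀ A ∈ G, A * Ω = Ω * A := by
    intro A hA
    have := casimir_inv G W hWG hGG w b hb hexp (LinearMap.mul F (End F V) + (LinearMap.mul F (End F V)).flip)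
      (fun f _ g _ => by simp [add_comm]) A hA
    rw [← sub_eq_zero, ← this]
    simp only [Ω, Finset.mul_sum, Finset.sum_mul, ← Finset.sum_sub_distrib]
    refine Finset.sum_congr rfl fun i _ => ?_
    simp only [LinearMap.add_apply, LinearMap.mul_apply', LinearMap.flip_apply, mul_smul_comm,
      smul_mul_assoc, ← smul_sub]
    congr 1
    noncomm_ring
  have hΩ : Ω ≠ 0 := by
    intro h0
    have h1 : LinearMap.trace F V Ω = finrank F W := by
      simp [Ω, map_sum, hw]
    rw [h0, map_zero] at h1
    have h2 : finrank F W = 0 := by exact_mod_cast h1.symm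
    exact hW (Submodule.finrank_eq_zero.mp h2)
  let Q : V →ₗ[F] V →ₗ[F] F := ∑ i, w i • (s.compl₁₂ (b i) (b i))
  have hQ : ∀ x y, Q x y = ∑ i, w i * s (b i x) (b i y) := by
    intro x y; simp [Q, LinearMap.sum_apply]
  have key : ∀ A ∈ G, ∀ x y, s (A x) (Ω y) = Q x (A y) := by
    intro A hA x y
    have h1 := casimir_inv G W hWG hGG w b hb hexp (s.compl₁₂ (LinearMap.applyₗ (R := F) x) (LinearMap.applyₗ (R := F) y))
      (fun f hf g hg => by
        simpa using hs f (hWG hf) g (hWG hg) x y) A hA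
    rw [hQ, ← sub_eq_zero, ← h1]
    simp only [Ω, LinearMap.sum_apply, map_sum, ← Finset.sum_sub_distrib]
    refine Finset.sum_congr rfl fun i _ => ?_
    simp [hs A hA (b i) (hWG (hb i)), mul_sub]
  have hΩc : ∀ A ∈ G, ∀ y, Ω (A y) = A (Ω y) := fun A hA y =>
    (LinearMap.congr_fun (hcomm A hA) y).symm
  have hQ0 : ∀ x, Q x = 0 := by
    intro x
    apply hD
    intro A hA B hB y
    have h1 := key A hA x (B y)
    have h2 := key B hB x (A y)
    rw [hΩc B hB, hs A hA B hB, ← hΩc A hA, h2] at h1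
    simp [h1]
  have hz : ∀ x y, s x (Ω y) = 0 := by
    intro x y
    have : s.flip (Ω y) = 0 := by
      apply hD
      intro A hA B hB v
      have := key _ (hWG (hGG A hA B hB)) v y
      rw [hQ0] at this
      exact this
    exact LinearMap.congr_fun this x
  have htop : LinearMap.range Ω = ⊤ := by
    refine (hirr _ ?_).resolve_left (fun h => hΩ (LinearMap.range_eq_bot.mp h))
    rintro A hA _ ⟨y, rfl⟩
    exact ⟨A y, hΩc A hA y⟩
  ext x y
  obtain ⟨z, rfl⟩ := LinearMap.range_eq_top.mp htop y
  exact hz x z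

theorem jacobson_poly {F R : Type*} [Field F] [CharZero F] [Ring R] [Algebra F R]
    (x a b : R) (hb : x * a - a * x = b) (hab : Commute a b) (q : Polynomial F) :
    x * Polynomial.aeval a q - Polynomial.aeval a q * x =
      Polynomial.aeval a (Polynomial.derivative q) * b := by
  have hx : x * a = a * x + b := by rw [← hb]; abel
  have hpow : ∀ n : ℕ, x * a ^ (n+1) - a ^ (n+1) * x = ((n:R)+1) * a ^ n * b := by
    intro n
    induction n with
    | zero => simp [hb]
    | succ n ih =>
      have h1 : x * a ^ (n+1) = a ^ (n+1) * x + ((n:R)+1) * a ^ n * b := by rw [← ih]; abel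
      have h2 : x * a ^ (n+1+1) = (x * a ^ (n+1)) * a := by rw [pow_succ a (n+1), mul_assoc]
      rw [h2, h1, add_mul, mul_assoc _ x a, hx, mul_assoc _ b a, ← hab.eq, pow_succ a (n+1)]
      push_cast
      rw [pow_succ a n]
      noncomm_ring
  induction q using Polynomial.induction_on' with
  | add p q hp hq =>
    simp only [map_add, mul_add, add_mul]
    rw [← hp, ← hq]; abel
  | monomial n c =>
    cases n with
    | zero =>
      simp [Algebra.commutes]
    | succ n =>
      rw [Polynomial.derivative_monomial, Polynomial.aeval_monomial, Polynomial.aeval_monomial,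
        ← mul_assoc, ← Algebra.commutes c x, mul_assoc, mul_assoc, ← mul_sub, hpow, map_mul]
      simp [mul_assoc]

theorem jacobson_nilp {F R : Type*} [Field F] [CharZero F] [Ring R] [Algebra F R]
    [FiniteDimensional F R]
    (x a b d : R) (hb : x * a - a * x = b) (hd : x * b - b * x = d) (hab : Commute a b)
    (hbd : Commute b d) : IsNilpotent b := by
  have hbpow : ∀ m : ℕ, ∃ r : R, (x * b ^ m - b ^ m * x) * b = b ^ m * r := by
    intro m
    have h := jacobson_poly (F := F) x b d hd hbd (Polynomial.X ^ m)
    simp only [map_pow, Polynomial.aeval_X] at h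
    rw [h]
    cases m with
    | zero => exact ⟨0, by simp⟩
    | succ n =>
      refine ⟨((n : R) + 1) * d, ?_⟩
      rw [mul_assoc, ← hbd.eq]
      rw [Polynomial.derivative_X_pow, Nat.add_sub_cancel]
      simp only [map_mul, map_pow, Polynomial.aeval_X, map_natCast]
      push_cast
      rw [pow_succ]
      have hc : Commute ((n : R) + 1) (b ^ n * b) :=
        (Nat.cast_commute n _).add_left (Commute.one_left _)
      rw [← mul_assoc (b ^ n * b), ← hc.eq]
      simp only [mul_assoc]
  have main : ∀ (n : ℕ) (q : Polynomial F) (m : ℕ), q.natDegree = n → q ≠ 0 →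
      Polynomial.aeval a q * b ^ m = 0 → IsNilpotent b := by
    intro n
    induction n using Nat.strong_induction_on with
    | _ n ih =>
      intro q m hq hq0 h
      by_cases hn : n = 0
      · subst hn
        rw [Polynomial.eq_C_of_natDegree_eq_zero hq] at h hq0
        rw [Polynomial.aeval_C, ← Algebra.smul_def] at h
        refine ⟨m, (smul_eq_zero.mp h).resolve_left ?_⟩
        intro h0
        exact hq0 (by rw [h0, map_zero])
      · have hlt : (Polynomial.derivative q).natDegree < n := by
          rw [← hq]; exact Polynomial.natDegree_derivative_lt (by omega)
        refine ih _ hlt (Polynomial.derivative q) (1 + m + 1) rfl ?_ ?_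
        · intro h0
          exact hn (hq ▸ Polynomial.derivative_eq_zero.mp h0)
        · obtain ⟨r, hr⟩ := hbpow m
          have h1 := jacobson_poly (F := F) x a b hb hab q
          set p := Polynomial.aeval a q
          rw [pow_succ, pow_add, pow_one, ← mul_assoc, ← mul_assoc, ← h1]
          calc (x * p - p * x) * b ^ m * b
              = x * (p * b ^ m) * b - p * ((x * b ^ m - b ^ m * x) * b)
                - (p * b ^ m) * x * b := by noncomm_ring
            _ = 0 := by rw [hr, ← mul_assoc p, h]; simp
  refine main _ (minpoly F a) 0 rfl (minpoly.ne_zero (Algebra.IsIntegral.isIntegral a)) ?_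
  simp

theorem toEnd_lie_eq {F L V : Type*} [Field F] [LieRing L] [LieAlgebra F L]
    [AddCommGroup V] [Module F V] [LieRingModule L V] [LieModule F L V] (a b : L) :
    LieModule.toEnd F L V ⁅a, b⁆ = LieModule.toEnd F L V a * LieModule.toEnd F L V b -
      LieModule.toEnd F L V b * LieModule.toEnd F L V a := by
  ext v
  simp

theorem mem_span_of_mem_derived {F L : Type*} [Field F] [LieRing L] [LieAlgebra F L] (y : L)
    (hy : y ∈ LieAlgebra.derivedSeries F L 1) :
    y ∈ Submodule.span F {⁅p, q⁆ | (p : L) (q : L)} := by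
  rw [← LieAlgebra.coe_derivedSeries_one_eq]
  exact hy

theorem lie_mem_derived {F L : Type*} [Field F] [LieRing L] [LieAlgebra F L] (p q : L) :
    ⁅p, q⁆ ∈ LieAlgebra.derivedSeries F L 1 :=
  LieSubmodule.lie_mem_lie (LieSubmodule.mem_top p) (LieSubmodule.mem_top q)

theorem ideal_trivial {F L V : Type*} [Field F] [CharZero F] [LieRing L] [LieAlgebra F L]
    [AddCommGroup V] [Module F V] [LieRingModule L V] [LieModule F L V]
    [FiniteDimensional F V] [LieModule.IsIrreducible F L V] (I : LieIdeal F L)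
    (h : ∀ a ∈ I, IsNilpotent (LieModule.toEnd F L V a)) :
    ∀ a ∈ I, ∀ v : V, ⁅a, v⁆ = 0 := by
  have : Nontrivial V := LieModule.nontrivial_of_isIrreducible F L V
  have hn : LieModule.IsNilpotent I V :=
    (LieModule.isNilpotent_iff_forall' (R := F)).mpr fun ⟨x, hx⟩ => h x hx
  have hnt := LieModule.nontrivial_max_triv_of_isNilpotent F I V
  let U : LieSubmodule F L V :=
    { carrier := {v | ∀ a ∈ I, ⁅a, v⁆ = 0}
      add_mem' := by
        intro u v hu hv a ha
        rw [lie_add, hu a ha, hv a ha, add_zero]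
      zero_mem' := by intro a _; exact lie_zero a
      smul_mem' := by
        intro c v hv a ha
        rw [lie_smul, hv a ha, smul_zero]
      lie_mem := by
        intro x v hv a ha
        rw [leibniz_lie, hv a ha, lie_zero, add_zero]
        exact hv _ (lie_mem_left F L I a x ha) }
  have hU : U = ⊤ := by
    obtain ⟨⟨v, hv⟩, hv0⟩ := exists_ne (0 : LieModule.maxTrivSubmodule F I V)
    refine (eq_bot_or_eq_top U).resolve_left ?_
    intro hb
    have hvU : v ∈ U := by
      intro a ha
      exact hv ⟨a, ha⟩
    rw [hb] at hvU
    exact hv0 (Subtype.ext hvU)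
  intro a ha v
  have : v ∈ U := hU ▸ LieSubmodule.mem_top v
  exact this a ha

theorem trace_ideal_trivial {F L V : Type*} [Field F] [CharZero F] [LieRing L] [LieAlgebra F L]
    [AddCommGroup V] [Module F V] [LieRingModule L V] [LieModule F L V]
    [FiniteDimensional F V] [LieModule.IsIrreducible F L V] (K : LieIdeal F L)
    (h : ∀ a ∈ K, ∀ b ∈ K,
      LinearMap.trace F V (LieModule.toEnd F L V a * LieModule.toEnd F L V b) = 0) :
    ∀ a ∈ K, ∀ b ∈ K, Commute (LieModule.toEnd F L V a) (LieModule.toEnd F L V b) := by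
  have h0 : LieModule.traceForm F K V = 0 := by
    ext ⟨a, ha⟩ ⟨b, hb⟩
    exact h a ha b hb
  have hn := LieModule.isNilpotent_derivedSeries_of_traceForm_eq_zero h0
  rw [LieModule.isNilpotent_iff_forall' (R := F)] at hn
  have h1 := ideal_trivial (V := V) (⁅K, K⁆ : LieIdeal F L) (by
    intro x hx
    refine hn ⟨⟨x, LieSubmodule.lie_le_left K K hx⟩, ?_⟩
    rw [LieIdeal.derivedSeries_eq_derivedSeriesOfIdeal_comap, LieIdeal.mem_comap]
    exact hx)
  intro a ha b hb
  have h2 : LieModule.toEnd F L V ⁅a, b⁆ = 0 := by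
    ext v
    exact h1 _ (LieSubmodule.lie_mem_lie ha hb) v
  rw [toEnd_lie_eq, sub_eq_zero] at h2
  exact h2

theorem trace_ideal_central {F L V : Type*} [Field F] [CharZero F] [LieRing L] [LieAlgebra F L]
    [AddCommGroup V] [Module F V] [LieRingModule L V] [LieModule F L V]
    [FiniteDimensional F V] [LieModule.IsIrreducible F L V] (K : LieIdeal F L)
    (h : ∀ a ∈ K, ∀ b ∈ K,
      LinearMap.trace F V (LieModule.toEnd F L V a * LieModule.toEnd F L V b) = 0) :
    ∀ a ∈ K, ∀ b, Commute (LieModule.toEnd F L V b) (LieModule.toEnd F L V a) := by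
  have hc := trace_ideal_trivial K h
  have h1 := ideal_trivial (V := V) (⁅(⊤ : LieIdeal F L), K⁆ : LieIdeal F L) (by
    intro a ha
    have ha' : a ∈ (⁅(⊤ : LieIdeal F L), K⁆ : LieIdeal F L).toSubmodule := ha
    rw [LieSubmodule.lieIdeal_oper_eq_linear_span'] at ha'
    clear ha
    have : a ∈ K ∧ IsNilpotent (LieModule.toEnd F L V a) := by
      induction ha' using Submodule.span_induction with
      | mem u hu =>
        obtain ⟨x, -, a, ha, rfl⟩ := hu
        have hb : ⁅x, a⁆ ∈ K := lie_mem_right F L K x a ha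
        refine ⟨hb, ?_⟩
        refine jacobson_nilp (F := F) (LieModule.toEnd F L V x) (LieModule.toEnd F L V a) _
          (LieModule.toEnd F L V ⁅x, ⁅x, a⁆⁆) ?_ ?_ (hc _ ha _ hb)
          (hc _ hb _ (lie_mem_right F L K x _ hb))
        · rw [toEnd_lie_eq]
        · rw [toEnd_lie_eq x ⁅x, a⁆]
      | zero => exact ⟨K.zero_mem, by simp⟩
      | add u v _ _ hu hv =>
        refine ⟨K.add_mem hu.1 hv.1, ?_⟩
        rw [map_add]
        exact (hc _ hu.1 _ hv.1).isNilpotent_add hu.2 hv.2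
      | smul t u _ hu =>
        refine ⟨K.smul_mem t hu.1, ?_⟩
        rw [map_smul]
        exact hu.2.smul t
    exact this.2)
  intro a ha b
  have h2 : LieModule.toEnd F L V ⁅b, a⁆ = 0 := by
    ext v
    exact h1 _ (LieSubmodule.lie_mem_lie (LieSubmodule.mem_top b) ha) v
  rw [toEnd_lie_eq, sub_eq_zero] at h2
  exact h2

theorem derived_nondeg {F L V : Type*} [Field F] [CharZero F] [LieRing L] [LieAlgebra F L]
    [AddCommGroup V] [Module F V] [LieRingModule L V] [LieModule F L V]
    [FiniteDimensional F V] [LieModule.IsIrreducible F L V] (a : L)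
    (ha : a ∈ LieAlgebra.derivedSeries F L 1)
    (h : ∀ b ∈ LieAlgebra.derivedSeries F L 1,
      LinearMap.trace F V (LieModule.toEnd F L V a * LieModule.toEnd F L V b) = 0) :
    LieModule.toEnd F L V a = 0 := by
  have : Nontrivial V := LieModule.nontrivial_of_isIrreducible F L V
  let K : LieIdeal F L :=
    { carrier := {a | a ∈ LieAlgebra.derivedSeries F L 1 ∧
        ∀ b ∈ LieAlgebra.derivedSeries F L 1,
        LinearMap.trace F V (LieModule.toEnd F L V a * LieModule.toEnd F L V b) = 0}
      add_mem' := by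
        rintro u v ⟨hu, hu'⟩ ⟨hv, hv'⟩
        refine ⟨add_mem hu hv, fun b hb => ?_⟩
        rw [map_add, add_mul, map_add, hu' b hb, hv' b hb, add_zero]
      zero_mem' := ⟨zero_mem _, by simp⟩
      smul_mem' := by
        rintro c u ⟨hu, hu'⟩
        refine ⟨Submodule.smul_mem _ c hu, fun b hb => ?_⟩
        rw [map_smul, smul_mul_assoc, map_smul, hu' b hb, smul_zero]
      lie_mem := by
        rintro x u ⟨hu, hu'⟩
        refine ⟨lie_mem_right F L _ x u hu, fun b hb => ?_⟩
        have h1 := LieModule.traceForm_apply_lie_apply' F L V x u b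
        have h2 := hu' _ (lie_mem_right F L _ x b hb)
        rw [LieModule.traceForm_apply_apply, LieModule.traceForm_apply_apply] at h1
        rw [Module.End.mul_eq_comp] at h2 ⊢
        rw [h1, h2, neg_zero] }
  have hz := trace_ideal_central (V := V) K (fun a ha b hb => ha.2 b hb.1) a ⟨ha, h⟩
  set z := LieModule.toEnd F L V a with hzdef
  let U : LieSubmodule F L V :=
    { LinearMap.ker z with
      lie_mem := by
        intro x v hv
        have hv : z v = 0 := hv
        have := LinearMap.congr_fun (hz x).eq v
        simp only [Module.End.mul_apply, hv, map_zero] at this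
        exact this.symm }
  rcases eq_bot_or_eq_top U with hU | hU
  · exfalso
    have hker : LinearMap.ker z = ⊥ := by
      rw [eq_bot_iff]
      intro v hv
      have : v ∈ U := hv
      rw [hU] at this
      exact this
    have hunit : IsUnit z := (LinearMap.isUnit_iff_ker_eq_bot z).mpr hker
    obtain ⟨u, hu⟩ := hunit
    have hcu : ∀ x, Commute (LieModule.toEnd F L V x) (↑u⁻¹ : Module.End F V) := by
      intro x
      have := hz x
      rw [← hu] at this
      exact this.units_inv_right
    have ht : ∀ y ∈ LieAlgebra.derivedSeries F L 1,
        LinearMap.trace F V (LieModule.toEnd F L V y * (↑u⁻¹ : Module.End F V)) = 0 := by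
      intro y hy
      have hy' := mem_span_of_mem_derived y hy
      clear hy
      induction hy' using Submodule.span_induction with
      | mem w hw =>
        obtain ⟨p, q, rfl⟩ := hw
        rw [toEnd_lie_eq, sub_mul, map_sub, mul_assoc, (hcu q).eq, ← mul_assoc,
          LinearMap.trace_mul_comm, ← mul_assoc, sub_self]
      | zero => simp
      | add u v _ _ hu hv => rw [map_add, add_mul, map_add, hu, hv, add_zero]
      | smul t u _ hu => rw [map_smul, smul_mul_assoc, map_smul, hu, smul_zero]
    have h3 := ht a ha
    rw [← hzdef, ← hu, Units.mul_inv, LinearMap.trace_one] at h3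
    have h4 : Module.finrank F V = 0 := by exact_mod_cast h3
    exact Module.finrank_pos.ne' h4
  · ext v
    have : v ∈ U := hU ▸ LieSubmodule.mem_top v
    exact this

/-- Application of the Schur-type lemma: if `𝔤` is a finite-dimensional reductive Lie
algebra over `𝔽 = ℝ` or `ℂ`, `V` is a finite-dimensional irreducible `𝔤`-module on which
`[𝔤,𝔤]` acts nontrivially, and a bilinear form `c` on `V` satisfies
`c (x, A·y) = c (y, A·x)` for all `A ∈ 𝔤`, then `c` is skew-symmetric and `𝔤`-invariant. -/
theorem bilinear_form_skew_and_invariant {𝔽 : Type*} [RCLike 𝔽]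
    {𝔤 : Type*} [LieRing 𝔤] [LieAlgebra 𝔽 𝔤] [FiniteDimensional 𝔽 𝔤]
    (hred : LieAlgebra.IsReductive 𝔽 𝔤)
    {V : Type*} [AddCommGroup V] [Module 𝔽 V] [LieRingModule 𝔤 V] [LieModule 𝔽 𝔤 V]
    [FiniteDimensional 𝔽 V] [LieModule.IsIrreducible 𝔽 𝔤 V]
    (hV : ∃ (x : 𝔤) (v : V), x ∈ LieAlgebra.derivedSeries 𝔽 𝔤 1 ∧ ⁅x, v⁆ ≠ 0)
    (c : V →ₗ[𝔽] V →ₗ[𝔽] 𝔽)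
    (hc : ∀ (A : 𝔤) (x y : V), c x ⁅A, y⁆ = c y ⁅A, x⁆) :
    (∀ x y : V, c x y = - c y x) ∧
      (∀ (A : 𝔤) (x y : V), c ⁅A, x⁆ y + c x ⁅A, y⁆ = 0) := by
  have hs : c + c.flip = 0 := by
    refine core_lemma (LinearMap.range (LieModule.toEnd 𝔽 𝔤 V : 𝔤 →ₗ[𝔽] Module.End 𝔽 V))
      ((LieAlgebra.derivedSeries 𝔽 𝔤 1).toSubmodule.map
        (LieModule.toEnd 𝔽 𝔤 V : 𝔤 →ₗ[𝔽] Module.End 𝔽 V)) ?_ ?_ ?_ ?_ ?_ ?_ _ ?_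
    · rintro _ ⟨a, -, rfl⟩
      exact ⟨a, rfl⟩
    · rintro _ ⟨a, rfl⟩ _ ⟨b, rfl⟩
      exact ⟨⁅a, b⁆, lie_mem_derived a b, toEnd_lie_eq a b⟩
    · rintro _ ⟨a, ha, rfl⟩ h
      exact derived_nondeg a ha fun b hb => h _ ⟨b, hb, rfl⟩
    · intro h
      obtain ⟨x, v, hx, hv⟩ := hV
      have h1 : LieModule.toEnd 𝔽 𝔤 V x = 0 := by
        rw [← Submodule.mem_bot 𝔽, ← h]
        exact ⟨x, hx, rfl⟩
      exact hv (LinearMap.congr_fun h1 v)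
    · intro U hU
      let N : LieSubmodule 𝔽 𝔤 V :=
        { U with lie_mem := fun {x v} hv => hU _ ⟨x, rfl⟩ v hv }
      rcases eq_bot_or_eq_top N with h | h
      · left
        exact congrArg LieSubmodule.toSubmodule h
      · right
        exact congrArg LieSubmodule.toSubmodule h
    · intro l hl
      have h1 : ∀ y ∈ LieAlgebra.derivedSeries 𝔽 𝔤 1, ∀ v : V, l ⁅y, v⁆ = 0 := by
        intro y hy v
        have hy' := mem_span_of_mem_derived y hy
        clear hy
        induction hy' using Submodule.span_induction with
        | mem w hw =>
          obtain ⟨p, q, rfl⟩ := hw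
          have := hl _ ⟨p, rfl⟩ _ ⟨q, rfl⟩ v
          simpa using this
        | zero => simp
        | add u v _ _ hu hv => rw [add_lie, map_add, hu, hv, add_zero]
        | smul t u _ hu => rw [smul_lie, map_smul, hu, smul_zero]
      have htop : (⁅LieAlgebra.derivedSeries 𝔽 𝔤 1, (⊤ : LieSubmodule 𝔽 𝔤 V)⁆ :
          LieSubmodule 𝔽 𝔤 V) = ⊤ := by
        refine (eq_bot_or_eq_top _).resolve_left ?_
        intro h
        obtain ⟨x, v, hx, hv⟩ := hV
        have h2 : ⁅x, v⁆ ∈ (⁅LieAlgebra.derivedSeries 𝔽 𝔤 1, (⊤ : LieSubmodule 𝔽 𝔤 V)⁆ :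
          LieSubmodule 𝔽 𝔤 V) := LieSubmodule.lie_mem_lie hx (LieSubmodule.mem_top v)
        rw [h] at h2
        exact hv h2
      ext u
      have hu : u ∈ (⁅LieAlgebra.derivedSeries 𝔽 𝔤 1, (⊤ : LieSubmodule 𝔽 𝔤 V)⁆ :
          LieSubmodule 𝔽 𝔤 V).toSubmodule := by
        rw [htop]; exact Submodule.mem_top
      rw [LieSubmodule.lieIdeal_oper_eq_linear_span'] at hu
      induction hu using Submodule.span_induction with
      | mem w hw =>
        obtain ⟨p, hp, q, -, rfl⟩ := hw
        exact h1 p hp q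
      | zero => simp
      | add u v _ _ hu hv => rw [map_add, hu, hv]; simp
      | smul t u _ hu => rw [map_smul, hu]; simp
    · rintro _ ⟨A, rfl⟩ _ ⟨B, rfl⟩ x y
      have e1 := hc ⁅A, B⁆ x y
      rw [lie_lie, lie_lie, map_sub, map_sub, hc A x, hc B x, hc A y, hc B y] at e1
      change c ⁅A, x⁆ ⁅B, y⁆ + c ⁅B, y⁆ ⁅A, x⁆ = c ⁅B, x⁆ ⁅A, y⁆ + c ⁅A, y⁆ ⁅B, x⁆
      linear_combination e1
  have hskew : ∀ x y : V, c x y = - c y x := by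
    intro x y
    have := LinearMap.congr_fun (LinearMap.congr_fun hs x) y
    exact eq_neg_of_add_eq_zero_left this
  refine ⟨hskew, fun A x y => ?_⟩
  rw [hskew, hc A x y]
  simp
end

section
/- Let 𝔤 be a Lie algebra over a field 𝔽 and let V, W be 𝔤-modules. The set P of all linear maps ρ : V → W satisfying the Schur-type condition A ρ B = B ρ A for all A, B ∈ 𝔤 is a 𝔤-submodule of Hom(V,W) with respect to the action (A·ρ)(v) = A·ρ(v) − ρ(A·v). -/
/-- For a Lie algebra `𝔤` over a field `𝔽` and `𝔤`-modules `V`, `W`, the set of all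
linear maps `ρ : V → W` satisfying the Schur-type condition `A ρ B = B ρ A` for all
`A, B ∈ 𝔤` is a `𝔤`-submodule of `Hom(V,W)`, where `Hom(V,W)` carries the action
`(A·ρ)(v) = A·ρ(v) − ρ(A·v)` (this is the bracket of the `LieRingModule` instance
on `V →ₗ[𝔽] W`). -/
theorem schur_maps_form_lieSubmodule {𝔽 : Type*} [Field 𝔽]
    {𝔤 : Type*} [LieRing 𝔤] [LieAlgebra 𝔽 𝔤]
    {V : Type*} [AddCommGroup V] [Module 𝔽 V] [LieRingModule 𝔤 V] [LieModule 𝔽 𝔤 V]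
    {W : Type*} [AddCommGroup W] [Module 𝔽 W] [LieRingModule 𝔤 W] [LieModule 𝔽 𝔤 W] :
    ∃ P : LieSubmodule 𝔽 𝔤 (V →ₗ[𝔽] W),
      ∀ ρ : V →ₗ[𝔽] W,
        ρ ∈ P ↔ ∀ (A B : 𝔤) (v : V), ⁅A, ρ ⁅B, v⁆⁆ = ⁅B, ρ ⁅A, v⁆⁆ := by
  refine ⟨{ carrier := {ρ | ∀ (A B : 𝔤) (v : V), ⁅A, ρ ⁅B, v⁆⁆ = ⁅B, ρ ⁅A, v⁆⁆}
            add_mem' := ?_, zero_mem' := ?_, smul_mem' := ?_, lie_mem := ?_ }, ?_⟩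
  · intro ρ σ hρ hσ A B v
    simp only [LinearMap.add_apply, lie_add]
    rw [hρ A B v, hσ A B v]
  · intro A B v
    simp
  · intro c ρ hρ A B v
    simp only [LinearMap.smul_apply, lie_smul]
    rw [hρ A B v]
  · intro C ρ hρ A B v
    have hρ' : ∀ (A B : 𝔤) (v : V), ⁅A, ρ ⁅B, v⁆⁆ = ⁅B, ρ ⁅A, v⁆⁆ := hρ
    simp only [LieHom.lie_apply, lie_sub]
    have e1 := leibniz_lie A C (ρ ⁅B, v⁆)
    have e2 := leibniz_lie B C (ρ ⁅A, v⁆)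
    have e3 := congrArg (fun x => ⁅A, ρ x⁆) (leibniz_lie C B v)
    have e4 := congrArg (fun x => ⁅B, ρ x⁆) (leibniz_lie C A v)
    simp only [map_add, lie_add] at e3 e4
    rw [hρ' A ⁅C, B⁆ v, ← lie_skew C B, neg_lie] at e3
    rw [hρ' B ⁅C, A⁆ v, ← lie_skew C A, neg_lie] at e4
    rw [e1, e2, e3, e4, hρ' A B v, hρ' A B ⁅C, v⁆]
    abel
  · intro ρ
    exact Iff.rfl
end

section
/- Let 𝔤 be a Lie algebra over a field 𝔽 and let V, W be 𝔤-modules with V irreducible and [𝔤,𝔤]·V ≠ 0. If ρ : V → W is a 𝔤-module homomorphism (ρ(A·v) = A·ρ(v) for all A ∈ 𝔤, v ∈ V) which satisfies the Schur-type condition A ρ B = B ρ A for all A, B ∈ 𝔤, then ρ = 0. -/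
/-- If `V` is an irreducible `𝔤`-module on which `[𝔤,𝔤]` acts nontrivially and
`ρ : V → W` is a `𝔤`-module homomorphism which also satisfies the Schur-type
condition `A ρ B = B ρ A` for all `A, B ∈ 𝔤`, then `ρ = 0`. -/
theorem schur_equivariant_map_eq_zero {𝔽 : Type*} [Field 𝔽]
    {𝔤 : Type*} [LieRing 𝔤] [LieAlgebra 𝔽 𝔤]
    {V : Type*} [AddCommGroup V] [Module 𝔽 V] [LieRingModule 𝔤 V] [LieModule 𝔽 𝔤 V]
    [LieModule.IsIrreducible 𝔽 𝔤 V]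
    {W : Type*} [AddCommGroup W] [Module 𝔽 W] [LieRingModule 𝔤 W] [LieModule 𝔽 𝔤 W]
    (hV : ∃ (x : 𝔤) (v : V), x ∈ LieAlgebra.derivedSeries 𝔽 𝔤 1 ∧ ⁅x, v⁆ ≠ 0)
    (ρ : V →ₗ[𝔽] W)
    (hhom : ∀ (A : 𝔤) (v : V), ρ ⁅A, v⁆ = ⁅A, ρ v⁆)
    (hSchur : ∀ (A B : 𝔤) (v : V), ⁅A, ρ ⁅B, v⁆⁆ = ⁅B, ρ ⁅A, v⁆⁆) :
    ρ = 0 := by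
  obtain ⟨x, v, hx, hxv⟩ := hV
  let f : V →ₗ⁅𝔽, 𝔤⁆ W := { ρ with map_lie' := fun {A v} => hhom A v }
  have hker : ∀ w, w ∈ f.ker ↔ ρ w = 0 := fun w => LieModuleHom.mem_ker (f := f)
  have hx0 : ρ ⁅x, v⁆ = 0 := by
    have hx' : x ∈ (⁅(⊤ : LieIdeal 𝔽 𝔤), (⊤ : LieIdeal 𝔽 𝔤)⁆ : LieIdeal 𝔽 𝔤) := hx
    rw [← LieSubmodule.mem_toSubmodule, LieSubmodule.lieIdeal_oper_eq_linear_span'] at hx'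
    clear hx hxv
    induction hx' using Submodule.span_induction with
    | mem y hy =>
      obtain ⟨a, -, b, -, rfl⟩ := hy
      rw [lie_lie, map_sub, hhom a ⁅b, v⁆, hhom b ⁅a, v⁆, hSchur, sub_self]
    | zero => simp
    | add y z _ _ hy hz => rw [add_lie, map_add, hy, hz, add_zero]
    | smul c y _ hy => rw [smul_lie, map_smul, hy, smul_zero]
  have htop : f.ker = ⊤ := by
    refine (eq_bot_or_eq_top f.ker).resolve_left ?_
    intro h
    have := (hker _).2 hx0
    rw [h] at this
    exact hxv (by simpa using this)
  ext w
  exact (hker w).1 (htop ▸ LieSubmodule.mem_top w)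
end

section
/- Let 𝔤 be a finite-dimensional reductive Lie algebra over ℂ with Cartan subalgebra 𝔱, let V and W be finite-dimensional irreducible 𝔤-modules, and let ρ : V → W be a linear map satisfying the Schur-type condition A ρ B = B ρ A for all A, B ∈ 𝔤. If μ : 𝔱 → ℂ is a nonzero weight of V and x ∈ V_μ is a weight vector, then ρ(x) lies in the sum of the weight spaces W_κ taken over all weights κ of W that are scalar multiples of μ. -/
namespace SchurAux

open LieAlgebra LieModule

variable {𝔤 : Type*} [LieRing 𝔤] [LieAlgebra ℂ 𝔤] [FiniteDimensional ℂ 𝔤]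

/-- The quotient map as a morphism of Lie algebras. -/
def quotHom (𝔤 : Type*) [LieRing 𝔤] [LieAlgebra ℂ 𝔤] :
    𝔤 →ₗ⁅ℂ⁆ (𝔤 ⧸ LieAlgebra.center ℂ 𝔤) :=
  { (LieSubmodule.Quotient.mk' (LieAlgebra.center ℂ 𝔤) : 𝔤 →ₗ[ℂ] 𝔤 ⧸ LieAlgebra.center ℂ 𝔤) with
    map_lie' := fun {x y} => LieSubmodule.Quotient.mk_bracket _ x y }

/-- The quotient of a reductive Lie algebra by its centre has trivial radical. -/
lemma hasTrivialRadical_quot (hred : LieAlgebra.IsReductive ℂ 𝔤) :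
    HasTrivialRadical ℂ (𝔤 ⧸ LieAlgebra.center ℂ 𝔤) := by
  rw [hasTrivialRadical_iff_no_abelian_ideals]
  intro I hI
  set π : 𝔤 →ₗ⁅ℂ⁆ (𝔤 ⧸ LieAlgebra.center ℂ 𝔤) :=
    quotHom 𝔤 with hπ
  let J : LieIdeal ℂ 𝔤 := LieIdeal.comap π I
  have hker : ∀ x : 𝔤, π x = 0 ↔ x ∈ LieAlgebra.center ℂ 𝔤 := fun x =>
    LieSubmodule.Quotient.mk_eq_zero _
  have h1 : ⁅J, J⁆ ≤ LieAlgebra.center ℂ 𝔤 := by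
    rw [LieSubmodule.lieIdeal_oper_eq_span, LieSubmodule.lieSpan_le]
    rintro _ ⟨⟨a, ha⟩, ⟨b, hb⟩, rfl⟩
    change ⁅a, b⁆ ∈ LieAlgebra.center ℂ 𝔤
    rw [← hker, LieHom.map_lie]
    have := hI.trivial ⟨π a, by simpa [J] using ha⟩ ⟨π b, by simpa [J] using hb⟩
    simpa using congrArg Subtype.val this
  have h2 : ⁅⁅J, J⁆, ⁅J, J⁆⁆ = ⊥ := by
    rw [eq_bot_iff, LieSubmodule.lieIdeal_oper_eq_span, LieSubmodule.lieSpan_le]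
    rintro _ ⟨⟨a, ha⟩, ⟨b, hb⟩, rfl⟩
    change ⁅a, b⁆ = 0
    exact (LieModule.mem_maxTrivSubmodule ℂ 𝔤 𝔤 b).1 (h1 hb) a
  have hJ : IsSolvable J := by
    rw [LieAlgebra.isSolvable_iff ℂ]
    refine ⟨2, ?_⟩
    rw [LieIdeal.derivedSeries_eq_bot_iff]
    simpa [derivedSeriesOfIdeal_succ] using h2
  have hJz : J ≤ LieAlgebra.center ℂ 𝔤 := by
    rw [← hred]
    exact (LieIdeal.solvable_iff_le_radical ℂ 𝔤 J).1 hJ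
  rw [eq_bot_iff]
  intro q hq
  obtain ⟨a, rfl⟩ := LieSubmodule.Quotient.surjective_mk' _ q
  have : a ∈ J := by
    change π a ∈ I
    exact hq
  exact (hker a).2 (hJz this)

lemma center_le (𝔱 : LieSubalgebra ℂ 𝔤) [𝔱.IsCartanSubalgebra] {z : 𝔤}
    (hz : z ∈ LieAlgebra.center ℂ 𝔤) : z ∈ 𝔱 := by
  rw [← LieSubalgebra.IsCartanSubalgebra.self_normalizing (H := 𝔱),
    LieSubalgebra.mem_normalizer_iff]
  intro y _
  have h := (LieModule.mem_maxTrivSubmodule ℂ 𝔤 𝔤 z).1 hz y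
  rw [← lie_skew, h, neg_zero]
  exact 𝔱.zero_mem

lemma cartan_map (𝔱 : LieSubalgebra ℂ 𝔤) [𝔱.IsCartanSubalgebra] :
    (𝔱.map (quotHom 𝔤)).IsCartanSubalgebra := by
  set π : 𝔤 →ₗ⁅ℂ⁆ (𝔤 ⧸ LieAlgebra.center ℂ 𝔤) :=
    quotHom 𝔤 with hπ
  have hker : ∀ x : 𝔤, π x = 0 ↔ x ∈ LieAlgebra.center ℂ 𝔤 := fun x =>
    LieSubmodule.Quotient.mk_eq_zero _
  have hmem : ∀ x : 𝔤, π x ∈ 𝔱.map π → x ∈ 𝔱 := by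
    intro x hx
    obtain ⟨y, hy, hxy⟩ := (LieSubalgebra.mem_map _ _ _).1 hx
    have : x - y ∈ LieAlgebra.center ℂ 𝔤 := by
      rw [← hker, map_sub, hxy, sub_self]
    simpa using 𝔱.add_mem (center_le 𝔱 this) hy
  refine ⟨?_, ?_⟩
  · let f : 𝔱 →ₗ⁅ℂ⁆ (𝔱.map π) :=
      { toFun := fun x => ⟨π x, (LieSubalgebra.mem_map _ _ _).2 ⟨x, x.2, rfl⟩⟩
        map_add' := fun x y => by ext; simp
        map_smul' := fun c x => by ext; simp
        map_lie' := fun {x y} => by ext; simp }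
    have hf : Function.Surjective f := by
      rintro ⟨q, hq⟩
      obtain ⟨y, hy, hxy⟩ := (LieSubalgebra.mem_map _ _ _).1 hq
      exact ⟨⟨y, hy⟩, Subtype.ext hxy⟩
    exact hf.lieAlgebra_isNilpotent
  · refine le_antisymm ?_ (LieSubalgebra.le_normalizer _)
    intro q hq
    obtain ⟨a, rfl⟩ := LieSubmodule.Quotient.surjective_mk' _ q
    change π a ∈ _ at hq
    change π a ∈ _
    rw [LieSubalgebra.mem_normalizer_iff] at hq
    refine (LieSubalgebra.mem_map _ _ _).2 ⟨a, ?_, rfl⟩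
    rw [← LieSubalgebra.IsCartanSubalgebra.self_normalizing (H := 𝔱),
      LieSubalgebra.mem_normalizer_iff]
    intro y hy
    apply hmem
    rw [LieHom.map_lie]
    exact hq _ ((LieSubalgebra.mem_map _ _ _).2 ⟨y, hy, rfl⟩)

/-- Each generalised root space is either in the Cartan subalgebra, or a true root space. -/
lemma root_eigen (hred : LieAlgebra.IsReductive ℂ 𝔤)
    (𝔱 : LieSubalgebra ℂ 𝔤) [𝔱.IsCartanSubalgebra] (α : 𝔱 → ℂ) (e : 𝔤)
    (he : e ∈ rootSpace 𝔱 α) : e ∈ 𝔱 ∨ ∀ H : 𝔱, ⁅(H : 𝔤), e⁆ = α H • e := by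
  by_cases hα : α = 0
  · left
    subst hα
    rw [rootSpace_zero_eq ℂ 𝔤 𝔱] at he
    simpa using he
  right
  obtain ⟨H₀, hH₀⟩ : ∃ H, α H ≠ 0 := by
    by_contra! h
    exact hα (funext h)
  intro H
  set π : 𝔤 →ₗ⁅ℂ⁆ (𝔤 ⧸ LieAlgebra.center ℂ 𝔤) :=
    quotHom 𝔤 with hπ
  have hker : ∀ x : 𝔤, π x = 0 ↔ x ∈ LieAlgebra.center ℂ 𝔤 := fun x =>
    LieSubmodule.Quotient.mk_eq_zero _
  have := hasTrivialRadical_quot hred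
  have : (𝔱.map π).IsCartanSubalgebra := cartan_map 𝔱
  have hss := IsKilling.isSemisimple_ad_of_mem_isCartanSubalgebra (K := ℂ) (H := 𝔱.map π)
    ((LieSubalgebra.mem_map _ _ _).2 ⟨(H : 𝔤), H.2, rfl⟩ : π H ∈ 𝔱.map π)
  have hgen : π e ∈ (ad ℂ _ (π H)).maxGenEigenspace (α H) := by
    obtain ⟨k, hk⟩ := (mem_genWeightSpace _ _ _).1 he H
    rw [Module.End.mem_maxGenEigenspace]
    refine ⟨k, ?_⟩
    have hc : (ad ℂ _ (π H) - α H • (1 : Module.End ℂ (𝔤 ⧸ LieAlgebra.center ℂ 𝔤))) ∘ₗ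
        (π : 𝔤 →ₗ[ℂ] _) = (π : 𝔤 →ₗ[ℂ] _) ∘ₗ (toEnd ℂ 𝔱 𝔤 H - α H • 1) := by
      apply LinearMap.ext
      intro y
      have h1 : π ⁅(H : 𝔤), y⁆ = ⁅π H, π y⁆ := LieHom.map_lie _ _ _
      simp [LieSubalgebra.coe_bracket_of_module, h1]
    have := LinearMap.congr_fun (Module.End.commute_pow_left_of_commute hc k) e
    simpa [hk] using this
  rw [hss.isFinitelySemisimple.maxGenEigenspace_eq_eigenspace, Module.End.mem_eigenspace_iff,
    ad_apply, ← LieHom.map_lie, ← map_smul, ← sub_eq_zero, ← map_sub, hker] at hgen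
  set z := ⁅(H : 𝔤), e⁆ - α H • e with hz
  have hzr : z ∈ rootSpace 𝔱 α :=
    sub_mem ((rootSpace 𝔱 α).lie_mem (x := H) he) (SMulMemClass.smul_mem _ he)
  obtain ⟨k, hk⟩ := (mem_genWeightSpace _ _ _).1 hzr H₀
  have hpow : ∀ n : ℕ, ((toEnd ℂ 𝔱 𝔤 H₀ - α H₀ • (1 : Module.End ℂ 𝔤)) ^ n) z
      = (-α H₀) ^ n • z := by
    intro n
    induction n with
    | zero => simp
    | succ n ih =>
      have h0 : ⁅(H₀ : 𝔤), z⁆ = 0 := (LieModule.mem_maxTrivSubmodule ℂ 𝔤 𝔤 z).1 hgen H₀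
      rw [pow_succ', Module.End.mul_apply, ih, map_smul]
      simp [LieSubalgebra.coe_bracket_of_module, h0, pow_succ, smul_smul]
  rw [hpow] at hk
  have : z = 0 := (smul_eq_zero.1 hk).resolve_left (pow_ne_zero _ (neg_ne_zero.2 hH₀))
  exact sub_eq_zero.1 this

/-- A Cartan subalgebra acts diagonalisably on an irreducible module. -/
lemma iSup_weightSpace (hred : LieAlgebra.IsReductive ℂ 𝔤)
    (𝔱 : LieSubalgebra ℂ 𝔤) [𝔱.IsCartanSubalgebra]
    {W : Type*} [AddCommGroup W] [Module ℂ W] [LieRingModule 𝔤 W] [LieModule ℂ 𝔤 W]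
    [FiniteDimensional ℂ W] [LieModule.IsIrreducible ℂ 𝔤 W] :
    (⨆ χ : 𝔱 → ℂ, (weightSpace W χ).toSubmodule) = ⊤ := by
  set P : Submodule ℂ W := ⨆ χ : 𝔱 → ℂ, (weightSpace W χ).toSubmodule with hP
  have hle : ∀ χ : 𝔱 → ℂ, (weightSpace W χ).toSubmodule ≤ P := fun χ =>
    le_iSup (fun χ : 𝔱 → ℂ => (weightSpace W χ).toSubmodule) χ
  have hroot : ∀ (α : 𝔱 → ℂ) (e : 𝔤), e ∈ rootSpace 𝔱 α → ∀ w ∈ P, ⁅e, w⁆ ∈ P := by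
    intro α e he w hw
    have : P ≤ P.comap (toEnd ℂ 𝔤 W e) := by
      conv_lhs => rw [hP]
      refine iSup_le fun χ => ?_
      intro v hv
      have hv' := (mem_weightSpace _ _).1 ((LieSubmodule.mem_toSubmodule _).1 hv)
      change ⁅e, v⁆ ∈ P
      rcases root_eigen hred 𝔱 α e he with h | h
      · have h1 : ⁅e, v⁆ = χ ⟨e, h⟩ • v := hv' ⟨e, h⟩
        rw [h1]
        exact P.smul_mem _ (hle χ hv)
      · refine hle (α + χ) ?_
        rw [LieSubmodule.mem_toSubmodule, mem_weightSpace]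
        intro H
        have h1 : ⁅(H : 𝔤), v⁆ = χ H • v := hv' H
        change ⁅(H : 𝔤), ⁅e, v⁆⁆ = _
        rw [leibniz_lie, h H, h1, lie_smul, smul_lie, ← add_smul]
        rfl
    exact this hw
  have hall : ∀ (a : 𝔤), ∀ w ∈ P, ⁅a, w⁆ ∈ P := by
    intro a w hw
    have htop := iSup_genWeightSpace_eq_top ℂ 𝔱 𝔤
    have ha : a ∈ (⨆ χ : 𝔱 → ℂ, (genWeightSpace 𝔤 χ).toSubmodule) := by
      rw [← LieSubmodule.iSup_toSubmodule, htop]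
      trivial
    have : (⨆ χ : 𝔱 → ℂ, (genWeightSpace 𝔤 χ).toSubmodule) ≤
        P.comap ((toEnd ℂ 𝔤 W : 𝔤 →ₗ[ℂ] Module.End ℂ W).flip w) :=
      iSup_le fun χ e he => hroot χ e he w hw
    exact this ha
  let N : LieSubmodule ℂ 𝔤 W := { P with lie_mem := fun {a w} hw => hall a w hw }
  have : Nontrivial W := (LieSubmodule.nontrivial_iff ℂ 𝔤 W).1 inferInstance
  obtain ⟨χ, hχ⟩ := exists_nontrivial_weightSpace_of_isSolvable ℂ 𝔱 W
  obtain ⟨⟨v, hv⟩, hv0⟩ := exists_ne (0 : weightSpace W χ)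
  have hN : N ≠ ⊥ := by
    intro h
    have : v ∈ N := hle χ hv
    rw [h] at this
    exact hv0 (Subtype.ext this)
  have hN' : N = ⊤ := (eq_bot_or_eq_top N).resolve_left hN
  have : N.toSubmodule = ⊤ := by rw [hN']; rfl
  exact this

end SchurAux

/-- Let `𝔤` be a finite-dimensional reductive complex Lie algebra with Cartan
subalgebra `𝔱`, let `V`, `W` be finite-dimensional irreducible `𝔤`-modules, and let
`ρ : V → W` be linear with `A ρ B = B ρ A` for all `A, B ∈ 𝔤`.  If `μ` is a nonzero
weight of `V` and `x ∈ V_μ`, then `ρ(x)` lies in the sum of the weight spaces `W_κ`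
over all weights `κ` of `W` that are scalar multiples of `μ`. -/
theorem schur_map_weight_vector_image {𝔤 : Type*} [LieRing 𝔤] [LieAlgebra ℂ 𝔤]
    [FiniteDimensional ℂ 𝔤]
    (hred : LieAlgebra.IsReductive ℂ 𝔤)
    (𝔱 : LieSubalgebra ℂ 𝔤) [𝔱.IsCartanSubalgebra]
    {V : Type*} [AddCommGroup V] [Module ℂ V] [LieRingModule 𝔤 V] [LieModule ℂ 𝔤 V]
    [FiniteDimensional ℂ V] [LieModule.IsIrreducible ℂ 𝔤 V]
    {W : Type*} [AddCommGroup W] [Module ℂ W] [LieRingModule 𝔤 W] [LieModule ℂ 𝔤 W]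
    [FiniteDimensional ℂ W] [LieModule.IsIrreducible ℂ 𝔤 W]
    (ρ : V →ₗ[ℂ] W)
    (hSchur : ∀ (A B : 𝔤) (v : V), ⁅A, ρ ⁅B, v⁆⁆ = ⁅B, ρ ⁅A, v⁆⁆)
    (μ : 𝔱 →ₗ[ℂ] ℂ) (hμ_ne : μ ≠ 0)
    (hμ_weight : ∃ y : V, y ≠ 0 ∧ ∀ H : 𝔱, ⁅(H : 𝔤), y⁆ = μ H • y)
    (x : V) (hx : ∀ H : 𝔱, ⁅(H : 𝔤), x⁆ = μ H • x) :
    ρ x ∈ Submodule.span ℂ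
      {w : W | ∃ k : ℂ, ∀ H : 𝔱, ⁅(H : 𝔤), w⁆ = (k * μ H) • w} := by
  obtain ⟨H₀, hH₀⟩ : ∃ H, μ H ≠ 0 := by
    by_contra! h
    exact hμ_ne (LinearMap.ext h)
  have key : ∀ H : 𝔱, μ H₀ • ⁅(H : 𝔤), ρ x⁆ = μ H • ⁅(H₀ : 𝔤), ρ x⁆ := by
    intro H
    have := hSchur H H₀ x
    rwa [hx, hx, map_smul, map_smul, lie_smul, lie_smul] at this
  have hmem : ρ x ∈ (⨆ χ : 𝔱 → ℂ, (LieModule.weightSpace W χ).toSubmodule) := by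
    rw [SchurAux.iSup_weightSpace hred 𝔱]
    trivial
  obtain ⟨f, hf, hsum⟩ := (Submodule.mem_iSup_iff_exists_finsupp _ _).1 hmem
  have hf' : ∀ (χ : 𝔱 → ℂ) (H : 𝔱), ⁅(H : 𝔤), f χ⁆ = χ H • f χ := fun χ H =>
    (LieModule.mem_weightSpace _ _).1 ((LieSubmodule.mem_toSubmodule _).1 (hf χ)) H
  have hind : iSupIndep fun χ : 𝔱 → ℂ => (LieModule.weightSpace W χ).toSubmodule :=
    ((LieSubmodule.iSupIndep_toSubmodule).2 (LieModule.iSupIndep_genWeightSpace ℂ 𝔱 W)).mono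
      fun χ => LieModule.weightSpace_le_genWeightSpace W χ
  rw [iSupIndep_iff_finsetSum_eq_zero_imp_eq_zero] at hind
  rw [← hsum]
  refine Submodule.sum_mem _ fun χ hχ => Submodule.subset_span ⟨χ H₀ / μ H₀, fun H => ?_⟩
  have hz : ∑ χ ∈ f.support, (μ H₀ * χ H - μ H * χ H₀) • f χ = 0 := by
    have := key H
    rw [← hsum, Finsupp.sum, lie_sum, lie_sum, Finset.smul_sum, Finset.smul_sum,
      ← sub_eq_zero, ← Finset.sum_sub_distrib] at this
    rw [← this]
    refine Finset.sum_congr rfl fun χ _ => ?_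
    rw [hf', hf', smul_smul, smul_smul, sub_smul]
  have h0 := hind f.support (fun χ => (μ H₀ * χ H - μ H * χ H₀) • f χ)
    (fun χ _ => Submodule.smul_mem _ _ (hf χ)) hz χ hχ
  have hc := (smul_eq_zero.1 h0).resolve_right (Finsupp.mem_support_iff.1 hχ)
  rw [hf']
  congr 1
  field_simp
  linear_combination hc
end

section
/- Let 𝔤 be a finite-dimensional reductive Lie algebra over ℂ with Cartan subalgebra 𝔱, let V and W be finite-dimensional irreducible 𝔤-modules, and let ρ : V → W be a linear map satisfying the Schur-type condition A ρ B = B ρ A for all A, B ∈ 𝔤. Suppose moreover that ρ is a weight vector of weight λ ≠ 0 for the induced action of 𝔱 on Hom(V,W), i.e. A·ρ(v) − ρ(A·v) = λ(A)ρ(v) for all A ∈ 𝔱, v ∈ V. If μ is a weight of V such that λ and μ are linearly independent, and x ∈ V_μ, then ρ(x) = 0. -/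
/-- Let `𝔤` be a finite-dimensional reductive complex Lie algebra with Cartan
subalgebra `𝔱`, `V`, `W` finite-dimensional irreducible `𝔤`-modules, and `ρ : V → W`
linear with `A ρ B = B ρ A` for all `A, B ∈ 𝔤`.  Suppose `ρ` is a weight vector of
nonzero weight `λ` for the induced `𝔱`-action on `Hom(V,W)`.  If `μ` is a weight of
`V` with `λ`, `μ` linearly independent and `x ∈ V_μ`, then `ρ(x) = 0`. -/
theorem schur_map_independent_weight_vanishes {𝔤 : Type*} [LieRing 𝔤] [LieAlgebra ℂ 𝔤]
    [FiniteDimensional ℂ 𝔤]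
    (hred : LieAlgebra.IsReductive ℂ 𝔤)
    (𝔱 : LieSubalgebra ℂ 𝔤) [𝔱.IsCartanSubalgebra]
    {V : Type*} [AddCommGroup V] [Module ℂ V] [LieRingModule 𝔤 V] [LieModule ℂ 𝔤 V]
    [FiniteDimensional ℂ V] [LieModule.IsIrreducible ℂ 𝔤 V]
    {W : Type*} [AddCommGroup W] [Module ℂ W] [LieRingModule 𝔤 W] [LieModule ℂ 𝔤 W]
    [FiniteDimensional ℂ W] [LieModule.IsIrreducible ℂ 𝔤 W]
    (ρ : V →ₗ[ℂ] W)
    (hSchur : ∀ (A B : 𝔤) (v : V), ⁅A, ρ ⁅B, v⁆⁆ = ⁅B, ρ ⁅A, v⁆⁆)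
    (lam : 𝔱 →ₗ[ℂ] ℂ) (hlam_ne : lam ≠ 0)
    (hρ_weight : ∀ (A : 𝔱) (v : V), ⁅(A : 𝔤), ρ v⁆ - ρ ⁅(A : 𝔤), v⁆ = lam A • ρ v)
    (μ : 𝔱 →ₗ[ℂ] ℂ)
    (hμ_weight : ∃ y : V, y ≠ 0 ∧ ∀ H : 𝔱, ⁅(H : 𝔤), y⁆ = μ H • y)
    (hindep : LinearIndependent ℂ ![lam, μ])
    (x : V) (hx : ∀ H : 𝔱, ⁅(H : 𝔤), x⁆ = μ H • x) :
    ρ x = 0 := by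
  by_contra hne
  have key : ∀ A B : 𝔱, μ B * lam A = μ A * lam B := by
    intro A B
    have hA : ∀ A : 𝔱, ⁅(A : 𝔤), ρ x⁆ = (lam A + μ A) • ρ x := by
      intro A
      have h := hρ_weight A x
      rw [hx, map_smul, sub_eq_iff_eq_add] at h
      rw [h, add_smul]
    have h := hSchur A B x
    rw [hx, hx, map_smul, map_smul, lie_smul, lie_smul, hA, hA, smul_smul, smul_smul] at h
    have h2 := smul_left_injective ℂ hne h
    linear_combination h2
  apply hlam_ne
  ext A
  rw [LinearIndependent.pair_iff] at hindep
  have h := (hindep (-(μ A)) (lam A) (by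
    ext B
    simp only [LinearMap.add_apply, LinearMap.smul_apply, smul_eq_mul, LinearMap.zero_apply]
    linear_combination key A B)).2
  simpa using h
end
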